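/- Assume f satisfies condition (OSC). If u is a strictly convex solution of the second boundary value problem with data (f, c), then for every x ∈ Ω one has f(x, ∇u(x)) + c ≤ (ℋ^{n−1}(∂Ω)/|Ω|)·max_{y ∈ ∂Ω̃} |y|/√(1 − |y|²) + 2·max_{Ω̄ × closure(Ω̃)} |f|, where ℋ^{n−1}(∂Ω) denotes the (n−1)-dimensional Hausdorff measure of ∂Ω. In particular there are constants Λ₁, Λ₂ > 0 depending only on n, Ω, Ω̃ and f such that Λ₁ ≤ div(∇u/√(1 − |∇u|²)) ≤ Λ₂ on Ω. -/

import Mathlib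

open Set MeasureTheory Matrix
open scoped Topology RealInnerProductSpace NNReal

noncomputable section

abbrev Euc (n : ℕ) := EuclideanSpace ℝ (Fin n)

variable {n : ℕ}

/-- Hessian matrix of `u` at `x`. -/
def Hess (u : Euc n → ℝ) (x : Euc n) : Matrix (Fin n) (Fin n) ℝ :=
  fun i j => iteratedFDeriv ℝ 2 u x ![EuclideanSpace.single i 1, EuclideanSpace.single j 1]

/-- `A ≤ B` in the sense of symmetric matrices. -/
def MatLE (A B : Matrix (Fin n) (Fin n) ℝ) : Prop := (B - A).PosSemidef

/-- The Minkowski mean-curvature operator `div (∇u / √(1 - |∇u|²))`. -/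
def MinkDiv (u : Euc n → ℝ) (x : Euc n) : ℝ :=
  ∑ i, fderiv ℝ (fun y => (Real.sqrt (1 - ‖gradient u y‖ ^ 2))⁻¹ * gradient u y i) x
    (EuclideanSpace.single i 1)

/-- The Euclidean mean-curvature operator `div (∇u / √(1 + |∇u|²))`. -/
def EucDiv (u : Euc n → ℝ) (x : Euc n) : ℝ :=
  ∑ i, fderiv ℝ (fun y => (Real.sqrt (1 + ‖gradient u y‖ ^ 2))⁻¹ * gradient u y i) x
    (EuclideanSpace.single i 1)

/-- `S(p) = (1/v)(Iₙ + p pᵀ / v²)`, `v = √(1-|p|²)`. -/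
def Smat (p : Euc n) : Matrix (Fin n) (Fin n) ℝ :=
  (Real.sqrt (1 - ‖p‖ ^ 2))⁻¹ •
    ((1 : Matrix (Fin n) (Fin n) ℝ) +
      (1 - ‖p‖ ^ 2)⁻¹ • Matrix.vecMulVec (fun i => p i) (fun j => p j))

/-- `B(p) = Iₙ + p pᵀ / (v (1 + v))`, `v = √(1-|p|²)`. -/
def Bmat (p : Euc n) : Matrix (Fin n) (Fin n) ℝ :=
  (1 : Matrix (Fin n) (Fin n) ℝ) +
    (Real.sqrt (1 - ‖p‖ ^ 2) * (1 + Real.sqrt (1 - ‖p‖ ^ 2)))⁻¹ •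
      Matrix.vecMulVec (fun i => p i) (fun j => p j)

/-- `A(x) = (1/v)·B(∇u)·D²u·B(∇u)`: its eigenvalues are the principal curvatures. -/
def Amat (u : Euc n → ℝ) (x : Euc n) : Matrix (Fin n) (Fin n) ℝ :=
  (Real.sqrt (1 - ‖gradient u x‖ ^ 2))⁻¹ •
    (Bmat (gradient u x) * Hess u x * Bmat (gradient u x))

/-- supremum of the quadratic form of `A` over the unit sphere (the operator
norm / largest eigenvalue for a positive semidefinite symmetric `A`). -/
def quadSup (A : Matrix (Fin n) (Fin n) ℝ) : ℝ :=
  ⨆ ξ : Metric.sphere (0 : Euc n) 1,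
    (fun i => (ξ : Euc n) i) ⬝ᵥ A.mulVec (fun i => (ξ : Euc n) i)

/-- The domains `Ω = {h̃ > 0}`, `Ω̃ = {h > 0}` are bounded uniformly convex domains
with smooth boundary, described by the defining functions `h̃` and `h`. -/
def DomainSetup (Ω Ωt : Set (Euc n)) (ht h : Euc n → ℝ) (θt θ : ℝ) : Prop :=
  IsOpen Ω ∧ IsOpen Ωt ∧ Bornology.IsBounded Ω ∧ Bornology.IsBounded Ωt ∧
  Ω.Nonempty ∧ Ωt.Nonempty ∧
  ContDiff ℝ (⊤ : ℕ∞) ht ∧ ContDiff ℝ (⊤ : ℕ∞) h ∧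
  Ω = {x | 0 < ht x} ∧ Ωt = {y | 0 < h y} ∧
  (∀ x ∈ frontier Ω, ‖gradient ht x‖ = 1) ∧
  (∀ y ∈ frontier Ωt, ‖gradient h y‖ = 1) ∧
  0 < θt ∧ 0 < θ ∧
  (∀ x : Euc n, MatLE (Hess ht x) ((-θt) • (1 : Matrix (Fin n) (Fin n) ℝ))) ∧
  (∀ y : Euc n, MatLE (Hess h y) ((-θ) • (1 : Matrix (Fin n) (Fin n) ℝ)))

/-- `f ∈ 𝒜`: `f` is `C²` on `Ω̄ × closure Ω̃` and concave in `x`. -/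
def InA (Ω Ωt : Set (Euc n)) (f : Euc n × Euc n → ℝ) : Prop :=
  ContDiffOn ℝ 2 f (closure Ω ×ˢ closure Ωt) ∧
  ∀ p ∈ closure Ωt, ConcaveOn ℝ (closure Ω) (fun x => f (x, p))

/-- Condition (OSC): `osc f ≤ (n/2)(|Ω̃|/|Ω|)^{1/n}`. -/
def OSCcond (Ω Ωt : Set (Euc n)) (f : Euc n × Euc n → ℝ) : Prop :=
  ∀ x ∈ closure Ω, ∀ y ∈ closure Ω, ∀ p ∈ closure Ωt, ∀ q ∈ closure Ωt,
    |f (x, p) - f (y, q)| ≤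
      ((n : ℝ) / 2) * ((volume Ωt).toReal / (volume Ω).toReal) ^ ((1 : ℝ) / n)

/-- `‖f‖_{C²(Ω̄ × closure Ω̃)} ≤ K`. -/
def C2Bound (Ω Ωt : Set (Euc n)) (f : Euc n × Euc n → ℝ) (K : ℝ) : Prop :=
  ContDiffOn ℝ 2 f (closure Ω ×ˢ closure Ωt) ∧
  ∀ z ∈ closure Ω ×ˢ closure Ωt,
    |f z| ≤ K ∧ ‖fderiv ℝ f z‖ ≤ K ∧ ‖iteratedFDeriv ℝ 2 f z‖ ≤ K

/-- `sup |D_x f| ≤ ε` on `Ω̄ × closure Ω̃`. -/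
def DxBound (Ω Ωt : Set (Euc n)) (f : Euc n × Euc n → ℝ) (ε : ℝ) : Prop :=
  ∀ x ∈ closure Ω, ∀ p ∈ closure Ωt, ‖fderiv ℝ (fun x' => f (x', p)) x‖ ≤ ε

/-- `sup |D_{xp} f| ≤ ε` on `Ω̄ × closure Ω̃`. -/
def DxpBound (Ω Ωt : Set (Euc n)) (f : Euc n × Euc n → ℝ) (ε : ℝ) : Prop :=
  ∀ x ∈ closure Ω, ∀ p ∈ closure Ωt,
    ‖fderiv ℝ (fun p' => fderiv ℝ (fun x' => f (x', p')) x) p‖ ≤ ε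

/-- A strictly convex solution of the second boundary value problem. -/
def IsStrictSol (Ω Ωt : Set (Euc n)) (f : Euc n × Euc n → ℝ) (c : ℝ) (u : Euc n → ℝ) : Prop :=
  ContDiffOn ℝ 2 u (closure Ω) ∧
  (∀ x ∈ closure Ω, (Hess u x).PosDef) ∧
  (∀ x ∈ closure Ω, ‖gradient u x‖ < 1) ∧
  (∀ x ∈ Ω, MinkDiv u x = f (x, gradient u x) + c) ∧
  gradient u '' Ω = Ωt

/-- A smooth uniformly convex solution of the second boundary value problem. -/
def IsSmoothSol (Ω Ωt : Set (Euc n)) (f : Euc n × Euc n → ℝ) (c : ℝ) (u : Euc n → ℝ) : Prop :=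
  ContDiffOn ℝ (⊤ : ℕ∞) u (closure Ω) ∧
  (∃ δ : ℝ, 0 < δ ∧ ∀ x ∈ closure Ω, MatLE (δ • (1 : Matrix (Fin n) (Fin n) ℝ)) (Hess u x)) ∧
  (∀ x ∈ closure Ω, ‖gradient u x‖ < 1) ∧
  (∀ x ∈ Ω, MinkDiv u x = f (x, gradient u x) + c) ∧
  gradient u '' Ω = Ωt

/-- A uniformly convex `C^{2}` solution of the second boundary value problem. -/
def IsUCSol (Ω Ωt : Set (Euc n)) (f : Euc n × Euc n → ℝ) (c : ℝ) (u : Euc n → ℝ) : Prop :=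
  ContDiffOn ℝ 2 u (closure Ω) ∧
  (∃ δ : ℝ, 0 < δ ∧ ∀ x ∈ closure Ω, MatLE (δ • (1 : Matrix (Fin n) (Fin n) ℝ)) (Hess u x)) ∧
  (∀ x ∈ closure Ω, ‖gradient u x‖ < 1) ∧
  (∀ x ∈ Ω, MinkDiv u x = f (x, gradient u x) + c) ∧
  gradient u '' Ω = Ωt

/-- A uniformly convex `C^{4,α}` solution of the second boundary value problem
for the Minkowski mean-curvature operator. -/
def IsC4Sol (Ω Ωt : Set (Euc n)) (f : Euc n × Euc n → ℝ) (c : ℝ) (u : Euc n → ℝ)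
    (α : ℝ) : Prop :=
  ContDiffOn ℝ 4 u (closure Ω) ∧
  (∃ C : ℝ≥0, HolderOnWith C (Real.toNNReal α) (fun x => iteratedFDeriv ℝ 4 u x) (closure Ω)) ∧
  (∃ δ : ℝ, 0 < δ ∧ ∀ x ∈ closure Ω, MatLE (δ • (1 : Matrix (Fin n) (Fin n) ℝ)) (Hess u x)) ∧
  (∀ x ∈ closure Ω, ‖gradient u x‖ < 1) ∧
  (∀ x ∈ Ω, MinkDiv u x = f (x, gradient u x) + c) ∧
  gradient u '' Ω = Ωt

/-- A uniformly convex `C^{4,α}` solution of the second boundary value problem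
for the Euclidean mean-curvature operator. -/
def IsC4SolE (Ω Ωt : Set (Euc n)) (f : Euc n × Euc n → ℝ) (c : ℝ) (u : Euc n → ℝ)
    (α : ℝ) : Prop :=
  ContDiffOn ℝ 4 u (closure Ω) ∧
  (∃ C : ℝ≥0, HolderOnWith C (Real.toNNReal α) (fun x => iteratedFDeriv ℝ 4 u x) (closure Ω)) ∧
  (∃ δ : ℝ, 0 < δ ∧ ∀ x ∈ closure Ω, MatLE (δ • (1 : Matrix (Fin n) (Fin n) ℝ)) (Hess u x)) ∧
  (∀ x ∈ Ω, EucDiv u x = f (x, gradient u x) + c) ∧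
  gradient u '' Ω = Ωt

/-- `ũ` is the Legendre transform of `u`. -/
def IsLegendre (Ω Ωt : Set (Euc n)) (u ut : Euc n → ℝ) : Prop :=
  ContDiffOn ℝ (⊤ : ℕ∞) ut (closure Ωt) ∧
  (∀ x ∈ closure Ω, ut (gradient u x) = ⟪x, gradient u x⟫ - u x) ∧
  (∀ x ∈ closure Ω, gradient ut (gradient u x) = x) ∧
  (∀ x ∈ closure Ω, Hess ut (gradient u x) = (Hess u x)⁻¹)

/-- The determinant of a positive definite matrix is at most the `n`-th power of the mean of its
eigenvalues. -/
lemma det_le_trace_div_pow {A : Matrix (Fin n) (Fin n) ℝ} (hn : 0 < n) (hA : A.PosDef) :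
    A.det ≤ (A.trace / n) ^ n := by
  have hev : ∀ i, 0 ≤ hA.isHermitian.eigenvalues i := fun i => (hA.eigenvalues_pos i).le
  have hn' : (n : ℝ) ≠ 0 := by positivity
  have key := Real.geom_mean_le_arith_mean_weighted Finset.univ (fun _ : Fin n => (n : ℝ)⁻¹)
    hA.isHermitian.eigenvalues (fun _ _ => by positivity) (by simp [hn']) (fun i _ => hev i)
  rw [hA.isHermitian.det_eq_prod_eigenvalues, hA.isHermitian.trace_eq_sum_eigenvalues]
  simp only [RCLike.ofReal_real_eq_id, id_eq]
  rw [Real.finsetProd_rpow _ _ (fun i _ => hev i), ← Finset.mul_sum] at key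
  have hprod : 0 ≤ ∏ i, hA.isHermitian.eigenvalues i := Finset.prod_nonneg fun i _ => hev i
  calc ∏ i, hA.isHermitian.eigenvalues i
      = ((∏ i, hA.isHermitian.eigenvalues i) ^ (n : ℝ)⁻¹) ^ n :=
        (Real.rpow_inv_natCast_pow hprod hn.ne').symm
    _ ≤ _ := by
        rw [div_eq_inv_mul]
        exact pow_le_pow_left₀ (Real.rpow_nonneg hprod _) key n

lemma ContDiffAt.gradient_of_two {u : Euc n → ℝ} {x : Euc n} (hu : ContDiffAt ℝ 2 u x) :
    ContDiffAt ℝ 1 (gradient u) x := by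
  have h1 : ContDiffAt ℝ 1 (fderiv ℝ u) x := hu.fderiv_right (by norm_num)
  exact (InnerProductSpace.toDual ℝ (Euc n)).symm.contDiff.contDiffAt.comp x h1

lemma fderiv_gradient_inner {u : Euc n → ℝ} {x : Euc n} (hu : ContDiffAt ℝ 2 u x) (a b : Euc n) :
    ⟪fderiv ℝ (gradient u) x a, b⟫ = fderiv ℝ (fderiv ℝ u) x a b := by
  have h1 : DifferentiableAt ℝ (fderiv ℝ u) x :=
    (hu.fderiv_right (m := 1) (by norm_num)).differentiableAt (by norm_num)
  have h2 : DifferentiableAt ℝ (gradient u) x :=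
    hu.gradient_of_two.differentiableAt (by norm_num)
  have h3 := h2.hasFDerivAt.inner ℝ (hasFDerivAt_const b x)
  have h4 : HasFDerivAt (fun y => fderiv ℝ u y b)
      ((ContinuousLinearMap.apply ℝ ℝ b).comp (fderiv ℝ (fderiv ℝ u) x)) x :=
    (ContinuousLinearMap.apply ℝ ℝ b).hasFDerivAt.comp x h1.hasFDerivAt
  have h5 : (fun y => ⟪gradient u y, b⟫) = fun y => fderiv ℝ u y b := by
    ext y
    simp [gradient]
  rw [h5] at h3
  simpa [real_inner_comm] using congrArg (fun T => T a) (h3.unique h4)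

lemma fderiv_gradient_apply_single {u : Euc n → ℝ} {x : Euc n} (hu : ContDiffAt ℝ 2 u x)
    (i j : Fin n) :
    fderiv ℝ (gradient u) x (EuclideanSpace.single i 1) j = Hess u x i j := by
  have := fderiv_gradient_inner hu (EuclideanSpace.single i 1) (EuclideanSpace.single j 1)
  simp only [EuclideanSpace.inner_single_right] at this
  simpa [Hess, iteratedFDeriv_two_apply] using this

lemma det_fderiv_gradient {u : Euc n → ℝ} {x : Euc n} (hu : ContDiffAt ℝ 2 u x) :
    (fderiv ℝ (gradient u) x).det = (Hess u x).det := by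
  rw [ContinuousLinearMap.det,
    ← LinearMap.det_toMatrix (EuclideanSpace.basisFun (Fin n) ℝ).toBasis, ← Matrix.det_transpose]
  congr 1
  ext i j
  rw [Matrix.transpose_apply, LinearMap.toMatrix_apply]
  simpa using fderiv_gradient_apply_single hu i j

lemma HasFDerivAt.sqrt_one_sub_norm_sq_inv {E : Type*} [NormedAddCommGroup E] [NormedSpace ℝ E]
    {g : E → Euc n} {g' : E →L[ℝ] Euc n}
    {x : E} (hg : HasFDerivAt g g' x) (h1 : ‖g x‖ < 1) :
    HasFDerivAt (fun y => (Real.sqrt (1 - ‖g y‖ ^ 2))⁻¹)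
      ((Real.sqrt (1 - ‖g x‖ ^ 2) ^ 3)⁻¹ • (innerSL ℝ (g x)).comp g') x := by
  have hpos : 0 < 1 - ‖g x‖ ^ 2 := by nlinarith [norm_nonneg (g x)]
  have h := (hasDerivAt_inv (Real.sqrt_ne_zero'.2 hpos)).comp_hasFDerivAt x
    ((hg.norm_sq.const_sub 1).sqrt hpos.ne')
  refine h.congr_fderiv ?_
  ext v
  have hs : Real.sqrt (1 - ‖g x‖ ^ 2) ≠ 0 := Real.sqrt_ne_zero'.2 hpos
  simp
  field_simp

/-- Expansion of the operator `MinkDiv` in terms of the Hessian. -/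
lemma minkDiv_eq {u : Euc n → ℝ} {x : Euc n} (hu : ContDiffAt ℝ 2 u x)
    (h1 : ‖gradient u x‖ < 1) :
    MinkDiv u x = (Real.sqrt (1 - ‖gradient u x‖ ^ 2))⁻¹ * (Hess u x).trace +
      (Real.sqrt (1 - ‖gradient u x‖ ^ 2) ^ 3)⁻¹ *
        ((fun i => gradient u x i) ⬝ᵥ (Hess u x) *ᵥ (fun i => gradient u x i)) := by
  have hg : HasFDerivAt (gradient u) (fderiv ℝ (gradient u) x) x :=
    (hu.gradient_of_two.differentiableAt (by norm_num)).hasFDerivAt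
  have hi (i : Fin n) : HasFDerivAt (fun y => gradient u y i)
      ((EuclideanSpace.proj i : Euc n →L[ℝ] ℝ).comp (fderiv ℝ (gradient u) x)) x :=
    (EuclideanSpace.proj i : Euc n →L[ℝ] ℝ).hasFDerivAt.comp x hg
  have hinner (i : Fin n) : ⟪gradient u x, fderiv ℝ (gradient u) x (EuclideanSpace.single i 1)⟫
      = (Hess u x *ᵥ (fun i => gradient u x i)) i := by
    rw [PiLp.inner_apply]
    simp [Matrix.mulVec, dotProduct, fderiv_gradient_apply_single hu]
  unfold MinkDiv
  have hterm (i : Fin n) := ((hg.sqrt_one_sub_norm_sq_inv h1).mul (hi i)).fderiv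
  simp_rw [show ∀ i : Fin n, (fun y => (Real.sqrt (1 - ‖gradient u y‖ ^ 2))⁻¹ * gradient u y i) =
    (fun y => (Real.sqrt (1 - ‖gradient u y‖ ^ 2))⁻¹) * (fun y => gradient u y i) from
    fun i => rfl, hterm]
  simp [fderiv_gradient_apply_single hu, hinner, Finset.sum_add_distrib, Matrix.trace, dotProduct,
    Finset.mul_sum]
  exact Finset.sum_congr rfl fun i _ => by ring

lemma trace_hess_le_minkDiv {u : Euc n → ℝ} {x : Euc n} (hu : ContDiffAt ℝ 2 u x)
    (h1 : ‖gradient u x‖ < 1) (hpos : (Hess u x).PosDef) :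
    (Hess u x).trace ≤ MinkDiv u x := by
  rw [minkDiv_eq hu h1]
  have hv : 0 < 1 - ‖gradient u x‖ ^ 2 := by nlinarith [norm_nonneg (gradient u x)]
  have hv1 : Real.sqrt (1 - ‖gradient u x‖ ^ 2) ≤ 1 :=
    Real.sqrt_le_one.2 (by nlinarith [norm_nonneg (gradient u x)])
  have h2 : 1 ≤ (Real.sqrt (1 - ‖gradient u x‖ ^ 2))⁻¹ :=
    (one_le_inv₀ (Real.sqrt_pos.2 hv)).2 hv1
  have h3 : 0 ≤ (fun i => gradient u x i) ⬝ᵥ (Hess u x) *ᵥ (fun i => gradient u x i) := by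
    simpa using hpos.posSemidef.dotProduct_mulVec_nonneg (fun i => gradient u x i)
  have h4 : 0 ≤ (Hess u x).trace := hpos.posSemidef.trace_nonneg
  have h5 : 0 ≤ (Real.sqrt (1 - ‖gradient u x‖ ^ 2) ^ 3)⁻¹ := by positivity
  nlinarith [mul_nonneg h5 h3]

/-- A positive upper bound for `MinkDiv u` controls the volume of the gradient image. -/
lemma volume_gradient_image_le {Ω : Set (Euc n)} {u : Euc n → ℝ} {K : ℝ} (hn : 0 < n)
    (hΩ : IsOpen Ω) (hu : ∀ x ∈ Ω, ContDiffAt ℝ 2 u x) (h1 : ∀ x ∈ Ω, ‖gradient u x‖ < 1)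
    (hpos : ∀ x ∈ Ω, (Hess u x).PosDef) (hK : ∀ x ∈ Ω, MinkDiv u x ≤ K) :
    volume (gradient u '' Ω) ≤ ENNReal.ofReal ((K / n) ^ n) * volume Ω := by
  calc volume (gradient u '' Ω)
      ≤ ∫⁻ x in Ω, ENNReal.ofReal |(fderiv ℝ (gradient u) x).det| :=
        addHaar_image_le_lintegral_abs_det_fderiv volume hΩ.measurableSet fun x hx =>
          ((hu x hx).gradient_of_two.differentiableAt (by norm_num)).hasFDerivAt.hasFDerivWithinAt
    _ ≤ ∫⁻ _ in Ω, ENNReal.ofReal ((K / n) ^ n) := by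
        refine setLIntegral_mono' hΩ.measurableSet fun x hx => ENNReal.ofReal_le_ofReal ?_
        rw [det_fderiv_gradient (hu x hx), abs_of_pos (hpos x hx).det_pos]
        refine (det_le_trace_div_pow hn (hpos x hx)).trans ?_
        have h0 : 0 ≤ (Hess u x).trace := (hpos x hx).posSemidef.trace_nonneg
        have := (trace_hess_le_minkDiv (hu x hx) (h1 x hx) (hpos x hx)).trans (hK x hx)
        gcongr
    _ = _ := by simp

lemma fderiv_fderiv_self_nonpos {g : Euc n → ℝ} {θ : ℝ} {x : Euc n}
    (hθ : 0 < θ) (hH : MatLE (Hess g x) ((-θ) • (1 : Matrix (Fin n) (Fin n) ℝ))) (w : Euc n) :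
    fderiv ℝ (fderiv ℝ g) x w w ≤ 0 := by
  have hw : w = ∑ i, w i • EuclideanSpace.single i (1 : ℝ) := by
    conv_lhs => rw [← (EuclideanSpace.basisFun (Fin n) ℝ).sum_repr w]
    simp
  have h1 : fderiv ℝ (fderiv ℝ g) x w w = (fun i => w i) ⬝ᵥ Hess g x *ᵥ (fun i => w i) := by
    conv_lhs => rw [hw]
    simp [dotProduct, Matrix.mulVec, Hess, iteratedFDeriv_two_apply, Finset.mul_sum,
      mul_comm]
    rw [Finset.sum_comm]
    exact Finset.sum_congr rfl fun i _ => Finset.sum_congr rfl fun j _ => mul_left_comm _ _ _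
  have h2 := hH.dotProduct_mulVec_nonneg (fun i => w i)
  have h3 : 0 ≤ (fun i => w i) ⬝ᵥ (fun i => w i) := by
    simpa using dotProduct_star_self_nonneg (fun i => w i)
  rw [h1]
  simp only [star_trivial, Matrix.sub_mulVec, Matrix.smul_mulVec, Matrix.one_mulVec,
    dotProduct_sub, dotProduct_smul, smul_eq_mul] at h2
  nlinarith

/-- A function with negative Hessian lies below its tangent planes. -/
lemma le_tangent_of_hess_le {g : Euc n → ℝ} {θ : ℝ} (hg : ContDiff ℝ 2 g) (hθ : 0 < θ)
    (hH : ∀ x, MatLE (Hess g x) ((-θ) • (1 : Matrix (Fin n) (Fin n) ℝ))) (x y : Euc n) :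
    g y ≤ g x + ⟪gradient g x, y - x⟫ := by
  have hline (s : ℝ) : HasDerivAt (fun s : ℝ => x + s • (y - x)) (y - x) s := by
    simpa using ((hasDerivAt_id s).smul_const (y - x)).const_add x
  have hd1 (s : ℝ) : HasDerivAt (fun s : ℝ => g (x + s • (y - x)))
      (fderiv ℝ g (x + s • (y - x)) (y - x)) s :=
    (hg.differentiable (by norm_num) _).hasFDerivAt.comp_hasDerivAt s (hline s)
  have hd2 (s : ℝ) : HasDerivAt (fun s : ℝ => fderiv ℝ g (x + s • (y - x)) (y - x))
      (fderiv ℝ (fderiv ℝ g) (x + s • (y - x)) (y - x) (y - x)) s := by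
    have h1 : DifferentiableAt ℝ (fderiv ℝ g) (x + s • (y - x)) :=
      (hg.fderiv_right (m := 1) (by norm_num)).differentiable (by norm_num) _
    have h2 := h1.hasFDerivAt.comp_hasDerivAt s (hline s)
    simpa using h2.clm_apply (hasDerivAt_const s (y - x))
  have hanti : Antitone (fun s : ℝ => fderiv ℝ g (x + s • (y - x)) (y - x)) :=
    antitone_of_deriv_nonpos (fun s => (hd2 s).differentiableAt) fun s => by
      rw [(hd2 s).deriv]
      exact fderiv_fderiv_self_nonpos hθ (hH _) _
  obtain ⟨c, hc, hc'⟩ := exists_hasDerivAt_eq_slope (fun s : ℝ => g (x + s • (y - x)))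
    (fun s : ℝ => fderiv ℝ g (x + s • (y - x)) (y - x)) zero_lt_one
    (fun s _ => (hd1 s).continuousAt.continuousWithinAt) (fun s _ => hd1 s)
  have h0 := hanti hc.1.le
  simp only [zero_smul, add_zero, one_smul, add_sub_cancel, sub_zero, div_one] at hc' h0
  have : ⟪gradient g x, y - x⟫ = fderiv ℝ g x (y - x) := by simp [gradient]
  linarith

/-- A set of diameter at most `d` whose slices in a unit direction have length at most `ℓ` has
volume at most `d ^ m * ℓ`. -/
lemma volume_le_of_slices {m : ℕ} {A : Set (Euc (m + 1))} (hA : MeasurableSet A) {ν : Euc (m + 1)}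
    (hν : ‖ν‖ = 1) {ℓ : ENNReal}
    (hl : ∀ x ∈ A, ∀ s : ℝ, 0 ≤ s → x + s • ν ∈ A → ENNReal.ofReal s ≤ ℓ) :
    volume A ≤ ℓ * Metric.ediam A ^ m := by
  have horth : Orthonormal ℝ (({0} : Set (Fin (m + 1))).domRestrict fun _ => ν) := by
    constructor
    · intro i
      exact hν
    · intro i j hij
      exact absurd (Subsingleton.elim i j) hij
  obtain ⟨b, hb⟩ := horth.exists_orthonormalBasis_extension_of_card_eq (by simp)
  have hb0 : b 0 = ν := hb 0 rfl
  let G : ℝ × (Fin m → ℝ) → Euc (m + 1) := fun p =>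
    b.repr.symm (WithLp.toLp 2 (Fin.cons p.1 p.2))
  have hG : MeasurePreserving G := by
    have h1 := (volume_preserving_piFinSuccAbove (fun _ : Fin (m + 1) => ℝ) 0).symm
    have h2 := b.measurePreserving_repr_symm.comp
      ((PiLp.volume_preserving_toLp (Fin (m + 1))).comp h1)
    have hGeq : G = b.repr.symm ∘ WithLp.toLp 2 ∘
        (MeasurableEquiv.piFinSuccAbove (fun _ : Fin (m + 1) => ℝ) 0).symm := by
      funext p
      simp only [G, Function.comp_apply, ← Fin.insertNth_zero']
      rfl
    rw [hGeq]
    exact h2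
  rw [← hG.measure_preimage hA.nullMeasurableSet, Measure.volume_eq_prod,
    Measure.prod_apply_symm (hG.measurable hA)]
  set S : Set (Fin m → ℝ) := {y | ∃ t, G (t, y) ∈ A} with hS
  have hslice : ∀ y, volume ((fun t => (t, y)) ⁻¹' (G ⁻¹' A)) ≤ S.indicator (fun _ => ℓ) y := by
    intro y
    by_cases hy : y ∈ S
    · rw [indicator_of_mem hy]
      refine (Real.volume_le_diam _).trans (Metric.ediam_le fun t ht t' ht' => ?_)
      wlog htt : t ≤ t' generalizing t t'
      · rw [edist_comm]
        exact this t' ht' t ht (le_of_not_ge htt)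
      have hadd : G (t', y) = G (t, y) + (t' - t) • ν := by
        apply b.repr.injective
        rw [map_add, map_smul, ← hb0, b.repr_self]
        ext i
        refine Fin.cases ?_ (fun j => ?_) i <;> simp [G]
      have := hl (G (t, y)) ht (t' - t) (by linarith) (hadd ▸ ht')
      rwa [edist_dist, Real.dist_eq, abs_sub_comm, abs_of_nonneg (by linarith)]
    · rw [indicator_of_notMem hy]
      have : (fun t => (t, y)) ⁻¹' (G ⁻¹' A) = ∅ := by
        ext t
        simp only [mem_preimage, mem_empty_iff_false, iff_false]
        exact fun h => hy ⟨t, h⟩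
      simp [this]
  have hdiam : Metric.ediam S ≤ Metric.ediam A := by
    refine Metric.ediam_le fun y hy y' hy' => ?_
    obtain ⟨t, ht⟩ := hy
    obtain ⟨t', ht'⟩ := hy'
    refine le_trans ?_ (Metric.edist_le_ediam_of_mem ht ht')
    refine edist_pi_le_iff.2 fun j => ?_
    rw [edist_dist, edist_dist, ← b.repr.dist_map (G (t, y)), Real.dist_eq, dist_eq_norm]
    refine ENNReal.ofReal_le_ofReal ?_
    have := PiLp.norm_apply_le (b.repr (G (t, y)) - b.repr (G (t', y'))) j.succ
    simpa [G] using this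
  calc ∫⁻ y, volume ((fun t => (t, y)) ⁻¹' (G ⁻¹' A))
      ≤ ∫⁻ y, S.indicator (fun _ => ℓ) y := lintegral_mono hslice
    _ ≤ ℓ * volume S := lintegral_indicator_const_le _ _
    _ ≤ ℓ * Metric.ediam A ^ m := by
        gcongr
        refine (Real.volume_pi_le_diam_pow S).trans ?_
        rw [Fintype.card_fin]
        gcongr

/-- A set bounded, with inward unit normals having a large component in a fixed coordinate
direction, has finite codimension one Hausdorff measure. -/
lemma hausdorffMeasure_lt_top_of_normal_coord {m : ℕ} {S : Set (Euc (m + 1))}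
    (hS : Bornology.IsBounded S) {N : Euc (m + 1) → Euc (m + 1)} (hN : ∀ y ∈ S, ‖N y‖ = 1)
    (hsupp : ∀ y ∈ S, ∀ z ∈ S, 0 ≤ ⟪N y, z - y⟫) (i : Fin (m + 1)) {σ : ℝ} (hσ : |σ| = 1)
    (hi : ∀ y ∈ S, 1 ≤ (m + 1) * (σ * N y i)) :
    μH[(m : ℝ)] S < ⊤ := by
  let f : S → (Fin m → ℝ) := fun y => i.removeNth (y : Euc (m + 1)).ofLp
  let K : ℝ≥0 := (m + 1) * m + m
  have hanti : AntilipschitzWith K f := by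
    refine AntilipschitzWith.of_le_mul_dist fun y z => ?_
    set ρ := dist (f y) (f z) with hρ
    have hρ0 : 0 ≤ ρ := dist_nonneg
    set w : Euc (m + 1) := (z : Euc (m + 1)) - y with hw
    have hcoord (j : Fin m) : |w (i.succAbove j)| ≤ ρ := by
      have := dist_le_pi_dist (f y) (f z) j
      rw [Real.dist_eq, abs_sub_comm] at this
      simpa [f, hw, Fin.removeNth] using this
    have hsum (v : Euc (m + 1)) (hv : ‖v‖ = 1) :
        |∑ j, v (i.succAbove j) * w (i.succAbove j)| ≤ m * ρ := by
      calc |∑ j, v (i.succAbove j) * w (i.succAbove j)|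
          ≤ ∑ j : Fin m, |v (i.succAbove j) * w (i.succAbove j)| := Finset.abs_sum_le_sum_abs _ _
        _ ≤ ∑ _j : Fin m, ρ := by
            refine Finset.sum_le_sum fun j _ => ?_
            rw [abs_mul]
            have h1 : |v (i.succAbove j)| ≤ 1 := by
              simpa [hv] using PiLp.norm_apply_le v (i.succAbove j)
            nlinarith [hcoord j, abs_nonneg (w (i.succAbove j)), abs_nonneg (v (i.succAbove j))]
        _ = m * ρ := by simp
    have hinner (v : Euc (m + 1)) :
        ⟪v, w⟫ = v i * w i + ∑ j, v (i.succAbove j) * w (i.succAbove j) := by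
      rw [PiLp.inner_apply, Fin.sum_univ_succAbove _ i]
      simp [mul_comm]
    have h1 := hsupp y y.2 z z.2
    have h2 := hsupp z z.2 y y.2
    rw [← neg_sub, ← hw, inner_neg_right, hinner] at h2
    rw [← hw, hinner] at h1
    have h3 := abs_le.1 (hsum _ (hN y y.2))
    have h4 := abs_le.1 (hsum _ (hN z z.2))
    have hy := hi y y.2
    have hz := hi z z.2
    have hσ2 : σ * σ = 1 := by
      rw [← abs_mul_abs_self, hσ, one_mul]
    have hwi : |w i| ≤ (m + 1) * (m * ρ) := by
      have habs : |w i| = |σ * w i| := by rw [abs_mul, hσ, one_mul]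
      have hm0 : (0 : ℝ) < m + 1 := by positivity
      have e1 : N y i * w i = (σ * N y i) * (σ * w i) := by linear_combination (-N y i * w i) * hσ2
      have e2 : N z i * w i = (σ * N z i) * (σ * w i) := by linear_combination (-N z i * w i) * hσ2
      rw [e1] at h1
      rw [e2] at h2
      rw [habs, abs_le]
      constructor
      · by_contra! hlt
        have hneg : σ * w i < 0 := lt_of_lt_of_le hlt (by simp; positivity)
        nlinarith
      · by_contra! hlt
        have hpos : 0 < σ * w i := lt_of_le_of_lt (by positivity) hlt
        nlinarith
    have hnorm : ‖w‖ ≤ ∑ j, |w j| := by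
      conv_lhs => rw [← (EuclideanSpace.basisFun (Fin (m + 1)) ℝ).sum_repr w]
      refine (norm_sum_le _ _).trans (Finset.sum_le_sum fun j _ => ?_)
      simp [norm_smul]
    calc dist y z = ‖w‖ := by rw [Subtype.dist_eq, dist_comm, dist_eq_norm]
      _ ≤ ∑ j, |w j| := hnorm
      _ = |w i| + ∑ j, |w (i.succAbove j)| := Fin.sum_univ_succAbove _ i
      _ ≤ (m + 1) * (m * ρ) + ∑ _j : Fin m, ρ :=
          add_le_add hwi (Finset.sum_le_sum fun j _ => hcoord j)
      _ = K * ρ := by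
          simp [K]
          ring
  have hbdd : Bornology.IsBounded (range f) := by
    obtain ⟨R, hR⟩ := hS.exists_norm_le
    refine (Metric.isBounded_iff_subset_closedBall 0).2 ⟨max R 0, ?_⟩
    rintro _ ⟨y, rfl⟩
    rw [mem_closedBall_zero_iff, pi_norm_le_iff_of_nonneg (le_max_right _ _)]
    intro j
    exact (PiLp.norm_apply_le (y : Euc (m + 1)) (i.succAbove j)).trans
      ((hR y y.2).trans (le_max_left _ _))
  have h1 := hanti.hausdorffMeasure_preimage_le (Nat.cast_nonneg m : (0 : ℝ) ≤ m) (range f)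
  rw [preimage_range] at h1
  have h2 := (isometry_subtype_coe (s := S)).hausdorffMeasure_image
    (Or.inl (Nat.cast_nonneg m : (0 : ℝ) ≤ m)) univ
  rw [image_univ, Subtype.range_coe] at h2
  rw [h2]
  refine h1.trans_lt (ENNReal.mul_lt_top (ENNReal.rpow_lt_top_of_nonneg (Nat.cast_nonneg m)
    ENNReal.coe_ne_top) ?_)
  have h3 := hausdorffMeasure_pi_real (ι := Fin m)
  rw [Fintype.card_fin] at h3
  rw [h3]
  exact hbdd.measure_lt_top

/-- A bounded set with everywhere supporting unit normals has finite codimension one Hausdorff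
measure. -/
lemma hausdorffMeasure_lt_top_of_normal {m : ℕ} {S : Set (Euc (m + 1))}
    (hS : Bornology.IsBounded S) {N : Euc (m + 1) → Euc (m + 1)} (hN : ∀ y ∈ S, ‖N y‖ = 1)
    (hsupp : ∀ y ∈ S, ∀ z ∈ S, 0 ≤ ⟪N y, z - y⟫) :
    μH[(m : ℝ)] S < ⊤ := by
  let σ : Bool → ℝ := fun b => if b then 1 else -1
  let P : Fin (m + 1) × Bool → Set (Euc (m + 1)) := fun q =>
    {y ∈ S | 1 ≤ (m + 1) * (σ q.2 * N y q.1)}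
  have hcover : S ⊆ ⋃ q, P q := by
    intro y hy
    by_contra hcon
    simp only [mem_iUnion, not_exists] at hcon
    have hlt (i : Fin (m + 1)) : (m + 1) * |N y i| < 1 := by
      have h1 : ¬ (1 ≤ (m + 1) * (σ true * N y i)) := fun h => hcon (i, true) ⟨hy, h⟩
      have h2 : ¬ (1 ≤ (m + 1) * (σ false * N y i)) := fun h => hcon (i, false) ⟨hy, h⟩
      simp only [σ, if_true, one_mul, not_le, Bool.false_eq_true, if_false] at h1 h2
      rcases abs_cases (N y i) with ⟨h, _⟩ | ⟨h, _⟩ <;> rw [h] <;> linarith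
    have hsq : ∑ i, N y i ^ 2 = 1 := by
      rw [← EuclideanSpace.real_norm_sq_eq, hN y hy, one_pow]
    have hle : ∑ i, N y i ^ 2 ≤ ∑ i : Fin (m + 1), |N y i| := by
      refine Finset.sum_le_sum fun i _ => ?_
      rw [← sq_abs]
      have h1 : |N y i| ≤ 1 := by simpa [hN y hy] using PiLp.norm_apply_le (N y) i
      nlinarith [abs_nonneg (N y i)]
    have hlt2 : ∑ i : Fin (m + 1), (m + 1) * |N y i| < ∑ _i : Fin (m + 1), (1 : ℝ) :=
      Finset.sum_lt_sum_of_nonempty Finset.univ_nonempty fun i _ => hlt i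
    rw [← Finset.mul_sum] at hlt2
    simp only [Finset.sum_const, Finset.card_univ, Fintype.card_fin, nsmul_eq_mul, mul_one,
      Nat.cast_add, Nat.cast_one] at hlt2
    nlinarith [(Nat.cast_nonneg m : (0 : ℝ) ≤ m)]
  refine (measure_mono hcover).trans_lt ((measure_iUnion_le _).trans_lt ?_)
  rw [tsum_fintype]
  refine ENNReal.sum_lt_top.2 fun q _ => ?_
  refine hausdorffMeasure_lt_top_of_normal_coord (hS.subset fun y hy => hy.1)
    (fun y hy => hN y hy.1) (fun y hy z hz => hsupp y hy.1 z hz.1) q.1 (σ := σ q.2) ?_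
    fun y hy => hy.2
  rcases q.2 <;> simp [σ]

lemma exists_isOpen_ediam_rpow_le {X : Type*} [PseudoEMetricSpace X] (T : Set X) {d : ℝ}
    {δ e : ENNReal} (hd : 0 ≤ d) (hT : Metric.ediam T < δ) (he : 0 < e) :
    ∃ U, IsOpen U ∧ T ⊆ U ∧ (U.Nonempty → T.Nonempty) ∧ Metric.ediam U ≤ δ ∧
      Metric.ediam U ^ d ≤ Metric.ediam T ^ d + e := by
  have hTtop : Metric.ediam T ≠ ⊤ := (hT.trans_le le_top).ne
  have hlim : Filter.Tendsto (fun a : ℝ≥0 => Metric.ediam T + 2 * (a : ENNReal)) (𝓝[>] 0)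
      (𝓝 (Metric.ediam T)) := by
    have h1 : Filter.Tendsto (fun a : ℝ≥0 => 2 * (a : ENNReal)) (𝓝[>] 0) (𝓝 (2 * 0)) :=
      ENNReal.Tendsto.const_mul
        ((ENNReal.tendsto_coe.2 Filter.tendsto_id).mono_left nhdsWithin_le_nhds)
        (Or.inr ENNReal.ofNat_ne_top)
    simpa using h1.const_add (Metric.ediam T)
  have hpow : Metric.ediam T ^ d < Metric.ediam T ^ d + e :=
    ENNReal.lt_add_right (ENNReal.rpow_ne_top_of_nonneg hd hTtop) he.ne'
  obtain ⟨a, ⟨ha1, ha2⟩, ha0⟩ := ((hlim.eventually_lt_const hT).and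
    ((hlim.ennrpow_const d).eventually_lt_const hpow)).and self_mem_nhdsWithin |>.exists
  have hle := Metric.ediam_thickening_le (s := T) a
  refine ⟨Metric.thickening a T, Metric.isOpen_thickening,
    Metric.self_subset_thickening (by exact_mod_cast ha0) T, fun hne => ?_, hle.trans ha1.le,
    (ENNReal.rpow_le_rpow hle hd).trans ha2.le⟩
  by_contra hcon
  rw [not_nonempty_iff_eq_empty.1 hcon, Metric.thickening_empty] at hne
  exact not_nonempty_empty hne

/-- Almost optimal open covers for the Hausdorff measure. -/
lemma exists_open_cover_tsum_ediam_le {X : Type*} [MetricSpace X] [MeasurableSpace X]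
    [BorelSpace X] {S : Set X} {d : ℝ} (hd : 0 < d) (hS : μH[d] S ≠ ⊤) {δ e : ENNReal}
    (hδ : 0 < δ) (hδ' : δ ≠ ⊤) (he : 0 < e) :
    ∃ U : ℕ → Set X, (∀ k, IsOpen (U k)) ∧ S ⊆ ⋃ k, U k ∧
      (∀ k, (U k).Nonempty → (U k ∩ S).Nonempty) ∧ (∀ k, Metric.ediam (U k) ≤ δ) ∧
      ∑' k, Metric.ediam (U k) ^ d ≤ μH[d] S + e := by
  have he2 : 0 < e / 2 := ENNReal.half_pos he.ne'
  have hδ2 : δ / 2 < δ := ENNReal.half_lt_self hδ.ne' hδ'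
  have hlt : (⨅ (t : ℕ → Set X) (_ : S ⊆ ⋃ n, t n) (_ : ∀ n, Metric.ediam (t n) ≤ δ / 2),
      ∑' n, ⨆ _ : (t n).Nonempty, Metric.ediam (t n) ^ d) < μH[d] S + e / 2 := by
    refine lt_of_le_of_lt ?_ (ENNReal.lt_add_right hS he2.ne')
    rw [Measure.hausdorffMeasure_apply]
    exact le_iSup₂_of_le (δ / 2) (ENNReal.half_pos hδ.ne') le_rfl
  simp only [iInf_lt_iff] at hlt
  obtain ⟨t, htS, htd, hsum⟩ := hlt
  obtain ⟨e', he'pos, hesum⟩ := ENNReal.exists_pos_sum_of_countable he2.ne' ℕ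
  have hle (k : ℕ) : Metric.ediam (t k ∩ S) ≤ Metric.ediam (t k) :=
    Metric.ediam_mono inter_subset_left
  choose U hUo hTU hne hUd hUe using fun k => exists_isOpen_ediam_rpow_le (t k ∩ S) hd.le
    (((hle k).trans (htd k)).trans_lt hδ2) (ENNReal.coe_pos.2 (he'pos k))
  refine ⟨U, hUo, ?_, ?_, hUd, ?_⟩
  · intro x hx
    obtain ⟨k, hk⟩ := mem_iUnion.1 (htS hx)
    exact mem_iUnion.2 ⟨k, hTU k ⟨hk, hx⟩⟩
  · intro k hk
    obtain ⟨x, hx⟩ := hne k hk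
    exact ⟨x, hTU k hx, hx.2⟩
  · have hterm (k : ℕ) : Metric.ediam (U k) ^ d ≤
        (⨆ _ : (t k).Nonempty, Metric.ediam (t k) ^ d) + e' k := by
      refine (hUe k).trans ?_
      gcongr
      rcases (t k).eq_empty_or_nonempty with h | h
      · simp [h, hd]
      · exact le_iSup_of_le h (ENNReal.rpow_le_rpow (hle k) hd.le)
    calc ∑' k, Metric.ediam (U k) ^ d
        ≤ ∑' k, ((⨆ _ : (t k).Nonempty, Metric.ediam (t k) ^ d) + (e' k : ENNReal)) :=
          ENNReal.tsum_le_tsum hterm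
      _ = (∑' k, ⨆ _ : (t k).Nonempty, Metric.ediam (t k) ^ d) + ∑' k, (e' k : ENNReal) :=
          ENNReal.tsum_add
      _ ≤ (μH[d] S + e / 2) + e / 2 := add_le_add hsum.le hesum.le
      _ = μH[d] S + e := by rw [add_assoc, ENNReal.add_halves]

/-- The volume of the thin layer `{0 < g < ε}` is asymptotically at most `ε` times the Hausdorff
measure of the boundary. -/
lemma exists_volume_layer_le {m : ℕ} (hm : 0 < m) {g : Euc (m + 1) → ℝ} (hgc : Continuous g)
    (hgrad : Continuous (gradient g)) (htan : ∀ x y, g y ≤ g x + ⟪gradient g x, y - x⟫)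
    {Ω : Set (Euc (m + 1))} (hΩ : Ω = {x | 0 < g x}) (hbdd : Bornology.IsBounded Ω)
    (hunit : ∀ x ∈ frontier Ω, ‖gradient g x‖ = 1) (hH : μH[(m : ℝ)] (frontier Ω) ≠ ⊤)
    {η : ℝ} (hη : 0 < η) (hη1 : η < 1) :
    ∃ ε₀ > 0, ∀ ε, 0 < ε → ε < ε₀ →
      volume {x | 0 < g x ∧ g x < ε} ≤
        ENNReal.ofReal (ε / (1 - η)) * (μH[(m : ℝ)] (frontier Ω) + ENNReal.ofReal η) ∧
      ∀ x, 0 < g x → g x < ε → ‖gradient g x‖ ≤ 1 + η := by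
  have hcomp : IsCompact (closure Ω) := hbdd.isCompact_closure
  have hopen : IsOpen Ω := hΩ ▸ isOpen_lt continuous_const hgc
  obtain ⟨δ, hδ, hunif⟩ := Metric.uniformContinuousOn_iff.1
    (hcomp.uniformContinuousOn_of_continuous hgrad.continuousOn) η hη
  obtain ⟨U, hUo, hUS, hUne, hUd, hUsum⟩ := exists_open_cover_tsum_ediam_le
    (d := (m : ℝ)) (by exact_mod_cast hm) hH (δ := ENNReal.ofReal (δ / 2))
    (e := ENNReal.ofReal η) (by simpa using hδ) ENNReal.ofReal_ne_top (by simpa using hη)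
  have hclose : ∀ k, ∀ x ∈ U k, ∀ y ∈ U k, dist x y < δ := by
    intro k x hx y hy
    have h1 := (Metric.edist_le_ediam_of_mem hx hy).trans (hUd k)
    rw [edist_dist, ENNReal.ofReal_le_ofReal_iff (by positivity)] at h1
    linarith
  have hnear : ∀ k, ∀ x₀ ∈ U k ∩ frontier Ω, ∀ x ∈ U k, x ∈ Ω →
      ‖gradient g x - gradient g x₀‖ < η := by
    intro k x₀ hx₀ x hx hxΩ
    rw [← dist_eq_norm]
    exact hunif x (subset_closure hxΩ) x₀ (frontier_subset_closure hx₀.2)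
      (hclose k x hx x₀ hx₀.1)
  have hcore : IsCompact (closure Ω \ ⋃ k, U k) := hcomp.diff (isOpen_iUnion hUo)
  have hcorepos : ∀ x ∈ closure Ω \ ⋃ k, U k, 0 < g x := by
    intro x hx
    by_contra hneg
    have hxΩ : x ∉ Ω := by
      rw [hΩ]
      exact hneg
    refine hx.2 (hUS ?_)
    rw [hopen.frontier_eq]
    exact ⟨hx.1, hxΩ⟩
  obtain ⟨ε₀, hε₀, hε₀'⟩ := hcore.exists_forall_le' hgc.continuousOn hcorepos
  refine ⟨ε₀, hε₀, fun ε hε hεε₀ => ?_⟩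
  have hcov : ∀ x, 0 < g x → g x < ε → ∃ k, x ∈ U k := by
    intro x hx hxε
    by_contra hcon
    have hxΩ : x ∈ Ω := by
      rw [hΩ]
      exact hx
    have := hε₀' x ⟨subset_closure hxΩ, by simpa using hcon⟩
    linarith
  constructor
  · have hsub : {x | 0 < g x ∧ g x < ε} ⊆ ⋃ k, ({x | 0 < g x ∧ g x < ε} ∩ U k) := by
      intro x hx
      obtain ⟨k, hk⟩ := hcov x hx.1 hx.2
      exact mem_iUnion.2 ⟨k, hx, hk⟩
    have hlayer : IsOpen {x | 0 < g x ∧ g x < ε} :=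
      (isOpen_lt continuous_const hgc).inter (isOpen_lt hgc continuous_const)
    have hpiece (k : ℕ) : volume ({x | 0 < g x ∧ g x < ε} ∩ U k) ≤
        ENNReal.ofReal (ε / (1 - η)) * Metric.ediam (U k) ^ (m : ℝ) := by
      rcases (U k).eq_empty_or_nonempty with hemp | hne
      · simp [hemp]
      obtain ⟨x₀, hx₀⟩ := hUne k hne
      refine (volume_le_of_slices (hlayer.inter (hUo k)).measurableSet (hunit x₀ hx₀.2)
        (ℓ := ENNReal.ofReal (ε / (1 - η))) ?_).trans ?_
      · rintro x ⟨hx, hxU⟩ s hs ⟨hx', hxU'⟩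
        refine ENNReal.ofReal_le_ofReal ?_
        rw [le_div_iff₀ (by linarith)]
        have h1 := htan (x + s • gradient g x₀) x
        have h2 := hnear k x₀ hx₀ _ hxU' (by rw [hΩ]; exact hx'.1)
        have h3 : 1 - η ≤ ⟪gradient g (x + s • gradient g x₀), gradient g x₀⟫ := by
          have h4 := abs_real_inner_le_norm
            (gradient g (x + s • gradient g x₀) - gradient g x₀) (gradient g x₀)
          rw [inner_sub_left, real_inner_self_eq_norm_sq, hunit x₀ hx₀.2] at h4
          have := (abs_le.1 h4).1
          linarith
        rw [show x - (x + s • gradient g x₀) = -(s • gradient g x₀) by abel, inner_neg_right,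
          inner_smul_right] at h1
        have := hx.1
        have := hx'.2
        nlinarith
      · rw [ENNReal.rpow_natCast]
        gcongr
        exact inter_subset_right
    calc volume {x | 0 < g x ∧ g x < ε}
        ≤ ∑' k, volume ({x | 0 < g x ∧ g x < ε} ∩ U k) :=
          (measure_mono hsub).trans (measure_iUnion_le _)
      _ ≤ ∑' k, ENNReal.ofReal (ε / (1 - η)) * Metric.ediam (U k) ^ (m : ℝ) :=
          ENNReal.tsum_le_tsum hpiece
      _ = ENNReal.ofReal (ε / (1 - η)) * ∑' k, Metric.ediam (U k) ^ (m : ℝ) := ENNReal.tsum_mul_left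
      _ ≤ _ := by gcongr
  · intro x hx hxε
    obtain ⟨k, hk⟩ := hcov x hx hxε
    obtain ⟨x₀, hx₀⟩ := hUne k ⟨x, hk⟩
    have h2 := hnear k x₀ hx₀ x hk (by rw [hΩ]; exact hx)
    have h3 := norm_le_norm_add_norm_sub' (gradient g x) (gradient g x₀)
    rw [hunit x₀ hx₀.2] at h3
    linarith

/-- A `C¹` ramp of slope at most one, vanishing on `(-∞, a]` and at least `1 - 3 * a` beyond `1`. -/
lemma exists_ramp {a : ℝ} (ha : 0 < a) (ha' : a < 1 / 4) :
    ∃ ψ : ℝ → ℝ, ContDiff ℝ 1 ψ ∧ (∀ t, t ≤ a → ψ t = 0) ∧ (∀ t, 0 ≤ ψ t) ∧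
      (∀ t, |deriv ψ t| ≤ 1) ∧ (∀ t, t ≤ 0 ∨ 1 ≤ t → deriv ψ t = 0) ∧
      ∀ t, 1 ≤ t → 1 - 3 * a ≤ ψ t := by
  let ρ : ℝ → ℝ := fun t => max 0 (min 1 (min ((t - a) / a) ((1 - t) / a)))
  have hρc : Continuous ρ := by fun_prop
  have hρ0 (t : ℝ) : 0 ≤ ρ t := le_max_left _ _
  have hρ1 (t : ℝ) : ρ t ≤ 1 := max_le zero_le_one (min_le_left _ _)
  have hρa (t : ℝ) (h : t ≤ a) : ρ t = 0 :=
    max_eq_left ((min_le_right _ _).trans ((min_le_left _ _).trans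
      (div_nonpos_of_nonpos_of_nonneg (by linarith) ha.le)))
  have hρb (t : ℝ) (h : 1 ≤ t) : ρ t = 0 :=
    max_eq_left ((min_le_right _ _).trans ((min_le_right _ _).trans
      (div_nonpos_of_nonpos_of_nonneg (by linarith) ha.le)))
  have hρm (t : ℝ) (h : 2 * a ≤ t) (h' : t ≤ 1 - a) : ρ t = 1 := by
    have h1 : 1 ≤ (t - a) / a := by rw [le_div_iff₀ ha]; linarith
    have h2 : 1 ≤ (1 - t) / a := by rw [le_div_iff₀ ha]; linarith
    simp only [ρ]
    rw [min_eq_left (le_min h1 h2), max_eq_right zero_le_one]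
  let ψ : ℝ → ℝ := fun t => ∫ s in a..t, ρ s
  have hd (t : ℝ) : HasDerivAt ψ (ρ t) t := hρc.integral_hasStrictDerivAt a t |>.hasDerivAt
  have hderiv : deriv ψ = ρ := funext fun t => (hd t).deriv
  have hmono : Monotone ψ :=
    monotone_of_deriv_nonneg (fun t => (hd t).differentiableAt) fun t => by
      rw [hderiv]
      exact hρ0 t
  have hzero (t : ℝ) (h : t ≤ a) : ψ t = 0 := by
    have : ∫ s in a..t, ρ s = ∫ s in a..t, (0 : ℝ) := by
      refine intervalIntegral.integral_congr fun s hs => ?_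
      rw [uIcc_of_ge h] at hs
      exact hρa s hs.2
    simpa [ψ] using this
  have hnonneg (t : ℝ) : 0 ≤ ψ t := by
    rcases le_total t a with h | h
    · exact (hzero t h).ge
    · exact (hzero a le_rfl).ge.trans (hmono h)
  refine ⟨ψ, ?_, hzero, hnonneg, fun t => ?_, fun t ht => ?_, fun t ht => ?_⟩
  · rw [contDiff_one_iff_deriv]
    exact ⟨fun t => (hd t).differentiableAt, hderiv ▸ hρc⟩
  · rw [hderiv, abs_of_nonneg (hρ0 t)]
    exact hρ1 t
  · rw [hderiv]
    rcases ht with h | h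
    · exact hρa t (by linarith)
    · exact hρb t h
  · have h1 : ψ (1 - a) - ψ (2 * a) = 1 - 3 * a := by
      simp only [ψ]
      rw [intervalIntegral.integral_interval_sub_left (hρc.intervalIntegrable _ _)
        (hρc.intervalIntegrable _ _)]
      have : ∫ s in (2 * a)..(1 - a), ρ s = ∫ s in (2 * a)..(1 - a), (1 : ℝ) := by
        refine intervalIntegral.integral_congr fun s hs => ?_
        rw [uIcc_of_le (by linarith)] at hs
        exact hρm s hs.1 hs.2
      rw [this, intervalIntegral.integral_const]
      simp
      ring
    have h2 := hmono (show 1 - a ≤ t by linarith)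
    have h3 := hnonneg (2 * a)
    linarith

/-- Integration by parts of the divergence of a bounded vector field against a cutoff. -/
lemma integral_mul_div_le {Ω : Set (Euc n)} (hΩ : IsOpen Ω) {V : Euc n → Euc n}
    (hV : ContDiffOn ℝ 1 V Ω) {M : ℝ} (hM : ∀ x ∈ Ω, ‖V x‖ ≤ M) {φ : Euc n → ℝ}
    (hφ : ContDiff ℝ 1 φ) (hφc : HasCompactSupport φ) (hφΩ : tsupport φ ⊆ Ω) :
    Integrable (fun x => φ x * ∑ i, fderiv ℝ (fun y => V y i) x (EuclideanSpace.single i 1)) ∧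
    ∫ x, φ x * ∑ i, fderiv ℝ (fun y => V y i) x (EuclideanSpace.single i 1) ≤
      M * ∫ x, ‖fderiv ℝ φ x‖ := by
  have hVi (i : Fin n) : ContDiffOn ℝ 1 (fun y => V y i) Ω :=
    (EuclideanSpace.proj i : Euc n →L[ℝ] ℝ).contDiff.comp_contDiffOn hV
  have hVd (i : Fin n) (x : Euc n) (hx : x ∈ Ω) : DifferentiableAt ℝ (fun y => V y i) x :=
    ((hVi i).contDiffAt (hΩ.mem_nhds hx)).differentiableAt (by norm_num)
  have hcs {a b : Euc n → ℝ} (ha : Continuous a) (hac : HasCompactSupport a) (haΩ : tsupport a ⊆ Ω)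
      (hb : ContinuousOn b Ω) : Integrable (fun x => a x * b x) := by
    refine Continuous.integrable_of_hasCompactSupport ?_ hac.mul_right
    refine (ha.continuousOn.mul hb).continuous_of_tsupport_subset hΩ ?_
    exact (tsupport_mul_subset_left).trans haΩ
  have hφ' (i : Fin n) : Continuous (fun x => fderiv ℝ φ x (EuclideanSpace.single i 1)) :=
    (hφ.continuous_fderiv (by norm_num)).clm_apply continuous_const
  have hφ'c (i : Fin n) : HasCompactSupport (fun x => fderiv ℝ φ x (EuclideanSpace.single i 1)) :=
    hφc.fderiv_apply ℝ _
  have hφ's (i : Fin n) : tsupport (fun x => fderiv ℝ φ x (EuclideanSpace.single i 1)) ⊆ Ω :=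
    (tsupport_fderiv_apply_subset ℝ _).trans hφΩ
  have hI1 (i : Fin n) : Integrable
      (fun x => φ x * fderiv ℝ (fun y => V y i) x (EuclideanSpace.single i 1)) :=
    hcs hφ.continuous hφc hφΩ
      (((hVi i).continuousOn_fderiv_of_isOpen hΩ (by norm_num)).clm_apply continuousOn_const)
  have hI2 (i : Fin n) : Integrable
      (fun x => fderiv ℝ φ x (EuclideanSpace.single i 1) * V x i) :=
    hcs (hφ' i) (hφ'c i) (hφ's i) (hVi i).continuousOn
  have hparts (i : Fin n) :
      ∫ x, φ x * fderiv ℝ (fun y => V y i) x (EuclideanSpace.single i 1) =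
        -∫ x, fderiv ℝ φ x (EuclideanSpace.single i 1) * V x i :=
    integral_mul_fderiv_eq_neg_fderiv_mul_of_integrable (hI2 i) (hI1 i)
      (hcs hφ.continuous hφc hφΩ (hVi i).continuousOn)
      (fun x _ => hφ.differentiable (by norm_num) x) (fun x hx => hVd i x (hφΩ hx))
  have hsum (x : Euc n) :
      ∑ i, fderiv ℝ φ x (EuclideanSpace.single i 1) * V x i = fderiv ℝ φ x (V x) := by
    conv_rhs => rw [← (EuclideanSpace.basisFun (Fin n) ℝ).sum_repr (V x)]
    simp [mul_comm]
  simp_rw [Finset.mul_sum]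
  refine ⟨integrable_finsetSum _ fun i _ => hI1 i, ?_⟩
  rw [integral_finsetSum _ fun i _ => hI1 i]
  simp_rw [hparts]
  rw [Finset.sum_neg_distrib, ← integral_finsetSum _ fun i _ => hI2 i, ← integral_neg,
    ← integral_const_mul]
  have hI3 : Integrable (fun x => ‖fderiv ℝ φ x‖) :=
    (hφ.continuous_fderiv (by norm_num)).norm.integrable_of_hasCompactSupport (hφc.fderiv ℝ).norm
  refine integral_mono (integrable_finsetSum _ fun i _ => hI2 i).neg (hI3.const_mul M) fun x => ?_
  simp only [hsum]
  by_cases hx : x ∈ Ω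
  · calc -(fderiv ℝ φ x (V x)) ≤ ‖fderiv ℝ φ x (V x)‖ := neg_le_abs _
      _ ≤ ‖fderiv ℝ φ x‖ * ‖V x‖ := ContinuousLinearMap.le_opNorm _ _
      _ ≤ ‖fderiv ℝ φ x‖ * M := by gcongr; exact hM x hx
      _ = M * ‖fderiv ℝ φ x‖ := mul_comm _ _
  · have : fderiv ℝ φ x = 0 := by
      by_contra h
      exact hx (hφΩ (support_fderiv_subset ℝ h))
    simp [this]

/-- The flux inequality on a concave superlevel set: a vector field of norm at most `M` whose
divergence is at least `c ≥ 0` satisfies `c |Ω| ≤ M ℋ(∂Ω)`. -/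
lemma mul_volume_le_mul_hausdorffMeasure_frontier {m : ℕ} (hm : 0 < m) {g : Euc (m + 1) → ℝ}
    (hg : ContDiff ℝ 1 g) (hgrad : Continuous (gradient g))
    (htan : ∀ x y, g y ≤ g x + ⟪gradient g x, y - x⟫)
    {Ω : Set (Euc (m + 1))} (hΩ : Ω = {x | 0 < g x}) (hbdd : Bornology.IsBounded Ω)
    (hunit : ∀ x ∈ frontier Ω, ‖gradient g x‖ = 1)
    {V : Euc (m + 1) → Euc (m + 1)} (hV : ContDiffOn ℝ 1 V Ω) {M : ℝ} (hM0 : 0 ≤ M)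
    (hM : ∀ x ∈ Ω, ‖V x‖ ≤ M) {c : ℝ} (hc : 0 ≤ c)
    (hdiv : ∀ x ∈ Ω, c ≤ ∑ i, fderiv ℝ (fun y => V y i) x (EuclideanSpace.single i 1)) :
    c * (volume Ω).toReal ≤ M * (μH[(m : ℝ)] (frontier Ω)).toReal := by
  have hgc : Continuous g := hg.continuous
  have hopen : IsOpen Ω := hΩ ▸ isOpen_lt continuous_const hgc
  have hg0 : ∀ x ∈ frontier Ω, g x = 0 := by
    intro x hx
    rw [hΩ] at hx
    exact (frontier_lt_subset_eq continuous_const hgc hx).symm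
  have hHtop : μH[(m : ℝ)] (frontier Ω) ≠ ⊤ := by
    refine (hausdorffMeasure_lt_top_of_normal (N := gradient g)
      (hbdd.closure.subset frontier_subset_closure) hunit fun y hy z hz => ?_).ne
    have := htan y z
    rw [hg0 y hy, hg0 z hz] at this
    linarith
  set H := (μH[(m : ℝ)] (frontier Ω)).toReal with hHdef
  set v := (volume Ω).toReal with hv
  have hvol : volume Ω ≠ ⊤ := hbdd.measure_lt_top.ne
  have hH0 : 0 ≤ H := ENNReal.toReal_nonneg
  have key : ∀ η : ℝ, 0 < η → η < 1 / 4 →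
      c * ((1 - 3 * η) * (v - η / (1 - η) * (H + η))) ≤ M * ((1 + η) / (1 - η) * (H + η)) := by
    intro η hη hη4
    obtain ⟨ε₀, hε₀, hlayer⟩ := exists_volume_layer_le hm hgc hgrad htan hΩ hbdd hunit hHtop hη
      (by linarith)
    obtain ⟨ε, hε, hεε₀, hεη⟩ : ∃ ε, 0 < ε ∧ ε < ε₀ ∧ ε ≤ η :=
      ⟨min (ε₀ / 2) η, by positivity, (min_le_left _ _).trans_lt (by linarith), min_le_right _ _⟩
    obtain ⟨hvolT, hgradT⟩ := hlayer ε hε hεε₀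
    set T := {x | 0 < g x ∧ g x < ε} with hT
    have hTΩ : T ⊆ Ω := by
      intro x hx
      rw [hΩ]
      exact hx.1
    have hTmeas : MeasurableSet T :=
      ((isOpen_lt continuous_const hgc).inter (isOpen_lt hgc continuous_const)).measurableSet
    have hTtop : volume T ≠ ⊤ := ((measure_mono hTΩ).trans_lt hbdd.measure_lt_top).ne
    have hTreal : volume.real T ≤ ε / (1 - η) * (H + η) := by
      have h1 : 0 ≤ ε / (1 - η) := div_nonneg hε.le (by linarith)
      have h2 := ENNReal.toReal_mono (ENNReal.mul_ne_top ENNReal.ofReal_ne_top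
        (ENNReal.add_ne_top.2 ⟨hHtop, ENNReal.ofReal_ne_top⟩)) hvolT
      rwa [ENNReal.toReal_mul, ENNReal.toReal_ofReal h1,
        ENNReal.toReal_add hHtop ENNReal.ofReal_ne_top, ENNReal.toReal_ofReal hη.le] at h2
    obtain ⟨ψ, hψc, hψ0, hψnn, hψ1, hψd, hψbig⟩ := exists_ramp hη hη4
    set φ : Euc (m + 1) → ℝ := fun x => ψ (ε⁻¹ * g x) with hφdef
    have hφ : ContDiff ℝ 1 φ := hψc.comp (contDiff_const.mul hg)
    have hsupp : tsupport φ ⊆ {x | η * ε ≤ g x} := by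
      refine closure_minimal (fun x hx => ?_) (isClosed_le continuous_const hgc)
      by_contra hcon
      refine hx (hψ0 _ ?_)
      rw [inv_mul_le_iff₀ hε, mul_comm]
      exact (not_le.1 hcon).le
    have hφΩ : tsupport φ ⊆ Ω := by
      intro x hx
      rw [hΩ]
      have h0 : 0 < η * ε := by positivity
      exact h0.trans_le (hsupp hx)
    have hφc : HasCompactSupport φ :=
      Metric.isCompact_of_isClosed_isBounded (isClosed_tsupport φ) (hbdd.subset hφΩ)
    obtain ⟨hint, hle⟩ := integral_mul_div_le hopen hV hM hφ hφc hφΩ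
    have hφint : Integrable φ := hφ.continuous.integrable_of_hasCompactSupport hφc
    have hφderiv (x : Euc (m + 1)) :
        ‖fderiv ℝ φ x‖ ≤ T.indicator (fun _ => ε⁻¹ * (1 + η)) x := by
      have hd : HasFDerivAt φ (deriv ψ (ε⁻¹ * g x) • (ε⁻¹ • fderiv ℝ g x)) x :=
        (hψc.differentiable (by norm_num) _).hasDerivAt.comp_hasFDerivAt x
          ((hg.differentiable (by norm_num) x).hasFDerivAt.const_mul ε⁻¹)
      rw [hd.fderiv]
      by_cases hx : x ∈ T
      · rw [indicator_of_mem hx, norm_smul, norm_smul, Real.norm_eq_abs, Real.norm_eq_abs,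
          abs_of_pos (inv_pos.2 hε)]
        have h1 : ‖fderiv ℝ g x‖ ≤ 1 + η := by
          have h2 := hgradT x hx.1 hx.2
          rwa [gradient, LinearIsometryEquiv.norm_map] at h2
        have h3 : ε⁻¹ * ‖fderiv ℝ g x‖ ≤ ε⁻¹ * (1 + η) := by gcongr
        have h4 : 0 ≤ ε⁻¹ * ‖fderiv ℝ g x‖ := by positivity
        nlinarith [hψ1 (ε⁻¹ * g x), abs_nonneg (deriv ψ (ε⁻¹ * g x))]
      · rw [indicator_of_notMem hx, hψd, zero_smul, norm_zero]
        by_cases hx0 : 0 < g x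
        · right
          rw [le_inv_mul_iff₀ hε, mul_one]
          exact not_lt.1 fun h => hx ⟨hx0, h⟩
        · left
          exact mul_nonpos_of_nonneg_of_nonpos (inv_pos.2 hε).le (not_lt.1 hx0)
    have hgradint : ∫ x, ‖fderiv ℝ φ x‖ ≤ (1 + η) / (1 - η) * (H + η) := by
      calc ∫ x, ‖fderiv ℝ φ x‖ ≤ ∫ x, T.indicator (fun _ => ε⁻¹ * (1 + η)) x := by
            refine integral_mono ?_ ?_ hφderiv
            · exact (hφ.continuous_fderiv (by norm_num)).norm.integrable_of_hasCompactSupport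
                (hφc.fderiv ℝ).norm
            · exact (integrable_indicator_iff hTmeas).2 (integrableOn_const hTtop)
        _ = volume.real T * (ε⁻¹ * (1 + η)) := by
            rw [integral_indicator_const _ hTmeas, smul_eq_mul]
        _ ≤ (ε / (1 - η) * (H + η)) * (ε⁻¹ * (1 + η)) := by gcongr
        _ = _ := by
            have : 1 - η ≠ 0 := by linarith
            field_simp
    have hlow : (1 - 3 * η) * (v - η / (1 - η) * (H + η)) ≤ ∫ x, φ x := by
      have hdiffmeas : MeasurableSet (Ω \ T) := hopen.measurableSet.diff hTmeas
      have h1 : volume.real (Ω \ T) * (1 - 3 * η) ≤ ∫ x, φ x := by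
        rw [← smul_eq_mul, ← integral_indicator_const _ hdiffmeas]
        refine integral_mono ?_ hφint fun x => ?_
        · exact (integrable_indicator_iff hdiffmeas).2
            (integrableOn_const ((measure_mono sdiff_subset).trans_lt hbdd.measure_lt_top).ne)
        · by_cases hx : x ∈ Ω \ T
          · rw [indicator_of_mem hx]
            refine hψbig _ ?_
            rw [le_inv_mul_iff₀ hε, mul_one]
            have hx1 : 0 < g x := by
              have := hx.1
              rwa [hΩ] at this
            exact not_lt.1 fun h => hx.2 ⟨hx1, h⟩
          · rw [indicator_of_notMem hx]
            exact hψnn _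
      have h2 : volume.real (Ω \ T) = v - volume.real T :=
        measureReal_sdiff hTΩ hTmeas hvol
      have h3 : volume.real T ≤ η / (1 - η) * (H + η) := by
        refine hTreal.trans ?_
        have : 0 < 1 - η := by linarith
        gcongr
      rw [h2] at h1
      nlinarith
    calc c * ((1 - 3 * η) * (v - η / (1 - η) * (H + η))) ≤ c * ∫ x, φ x := by gcongr
      _ = ∫ x, c * φ x := (integral_const_mul _ _).symm
      _ ≤ _ := by
          refine integral_mono (hφint.const_mul c) hint fun x => ?_
          by_cases hx : x ∈ Ω
          · rw [mul_comm c]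
            exact mul_le_mul_of_nonneg_left (hdiv x hx) (hψnn _)
          · have : φ x = 0 := image_eq_zero_of_notMem_tsupport fun h => hx (hφΩ h)
            simp [this]
      _ ≤ M * ∫ x, ‖fderiv ℝ φ x‖ := hle
      _ ≤ _ := by gcongr
  have hlimL : Filter.Tendsto (fun η : ℝ => c * ((1 - 3 * η) * (v - η / (1 - η) * (H + η))))
      (𝓝[>] 0) (𝓝 (c * v)) := by
    have : ContinuousAt (fun η : ℝ => c * ((1 - 3 * η) * (v - η / (1 - η) * (H + η)))) 0 := by
      fun_prop (disch := norm_num)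
    simpa using this.tendsto.mono_left nhdsWithin_le_nhds
  have hlimR : Filter.Tendsto (fun η : ℝ => M * ((1 + η) / (1 - η) * (H + η)))
      (𝓝[>] 0) (𝓝 (M * H)) := by
    have : ContinuousAt (fun η : ℝ => M * ((1 + η) / (1 - η) * (H + η))) 0 := by
      fun_prop (disch := norm_num)
    simpa using this.tendsto.mono_left nhdsWithin_le_nhds
  refine le_of_tendsto_of_tendsto hlimL hlimR ?_
  filter_upwards [Ioo_mem_nhdsGT (show (0 : ℝ) < 1 / 4 by norm_num)] with η hη
  exact key η hη.1 hη.2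

lemma div_sqrt_one_sub_sq_le {a b : ℝ} (ha : 0 ≤ a) (hab : a ≤ b) (hb : b < 1) :
    a / Real.sqrt (1 - a ^ 2) ≤ b / Real.sqrt (1 - b ^ 2) := by
  have hb0 : 0 ≤ b := ha.trans hab
  have h1 : 0 < 1 - b ^ 2 := by nlinarith
  have h2 : 1 - b ^ 2 ≤ 1 - a ^ 2 := by nlinarith
  have := Real.sqrt_pos.2 h1
  gcongr

/-- A preconnected set meeting both a set and its complement meets the frontier. -/
lemma IsPreconnected.inter_frontier_nonempty_of_inter_compl {X : Type*} [TopologicalSpace X]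
    {C D : Set X} (hC : IsPreconnected C) (h1 : (C ∩ D).Nonempty) (h2 : (C ∩ Dᶜ).Nonempty) :
    (C ∩ frontier D).Nonempty := by
  by_contra hne
  have hfr (x : X) (hx : x ∈ C) : x ∈ closure D → x ∈ interior D := fun hcl => by
    by_contra hint
    exact hne ⟨x, hx, hcl, hint⟩
  obtain ⟨x, hxC, hxD⟩ := h1
  obtain ⟨y, hyC, hyD⟩ := h2
  obtain ⟨z, -, hz1, hz2⟩ := hC (interior D) (closure D)ᶜ isOpen_interior
    isClosed_closure.isOpen_compl
    (fun z hz => (em (z ∈ closure D)).imp (hfr z hz) id)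
    ⟨x, hxC, hfr x hxC (subset_closure hxD)⟩
    ⟨y, hyC, fun hcl => hyD (interior_subset (hfr y hyC hcl))⟩
  exact hz2 (interior_subset_closure hz1)

/-- On a bounded open set the radially increasing function `|y| / √(1 - |y|²)` is dominated by its
supremum over the boundary. -/
lemma norm_div_sqrt_le_sSup_frontier {D : Set (Euc n)} (hD : Bornology.IsBounded D)
    (hball : closure D ⊆ Metric.ball (0 : Euc n) 1) {p : Euc n} (hp : p ∈ D) :
    ‖p‖ / Real.sqrt (1 - ‖p‖ ^ 2) ≤
      sSup ((fun y : Euc n => ‖y‖ / Real.sqrt (1 - ‖y‖ ^ 2)) '' frontier D) := by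
  rcases eq_or_ne p 0 with rfl | hp0
  · have : 0 ≤ sSup ((fun y : Euc n => ‖y‖ / Real.sqrt (1 - ‖y‖ ^ 2)) '' frontier D) :=
      Real.sSup_nonneg (by rintro _ ⟨y, _, rfl⟩; positivity)
    simpa using this
  have hnp : 0 < ‖p‖ := norm_pos_iff.2 hp0
  have hlt (y : Euc n) (hy : y ∈ closure D) : ‖y‖ < 1 := by simpa using hball hy
  have hcompact : IsCompact (frontier D) :=
    hD.isCompact_closure.of_isClosed_subset isClosed_frontier frontier_subset_closure
  have hcont : ContinuousOn (fun y : Euc n => ‖y‖ / Real.sqrt (1 - ‖y‖ ^ 2)) (frontier D) := by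
    refine ContinuousOn.div (by fun_prop) (by fun_prop) fun y hy => ?_
    refine Real.sqrt_ne_zero'.2 ?_
    nlinarith [hlt y (frontier_subset_closure hy), norm_nonneg y]
  have hconn : IsPreconnected ((fun t : ℝ => t • p) '' Ici 1) :=
    isPreconnected_Ici.image _ (by fun_prop)
  obtain ⟨q, ⟨t, ht, rfl⟩, hq⟩ : (((fun t : ℝ => t • p) '' Ici 1) ∩ frontier D).Nonempty := by
    refine hconn.inter_frontier_nonempty_of_inter_compl ⟨p, ⟨1, by simp, by simp⟩, hp⟩ ?_
    refine ⟨(1 + ‖p‖⁻¹) • p, ⟨1 + ‖p‖⁻¹, by simp, rfl⟩, fun hmem => ?_⟩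
    have h1 := hlt _ (subset_closure hmem)
    rw [norm_smul, Real.norm_of_nonneg (by positivity), add_mul, inv_mul_cancel₀ hnp.ne'] at h1
    linarith
  have hle : ‖p‖ ≤ ‖t • p‖ := by
    rw [norm_smul, Real.norm_of_nonneg (zero_le_one.trans ht)]
    exact le_mul_of_one_le_left hnp.le ht
  exact (div_sqrt_one_sub_sq_le hnp.le hle (hlt _ (frontier_subset_closure hq))).trans
    (le_csSup (hcompact.bddAbove_image hcont) ⟨_, hq, rfl⟩)

/-- The integrated mean-curvature estimate: a lower bound for `div (∇u / √(1 - |∇u|²))` is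
controlled by the flux through the boundary. -/
lemma minkDiv_lower_bound_le (hn : 2 ≤ n) {Ω Ωt : Set (Euc n)} {ht h : Euc n → ℝ} {θt θ : ℝ}
    (hdom : DomainSetup Ω Ωt ht h θt θ) (hball : closure Ωt ⊆ Metric.ball (0 : Euc n) 1)
    {u : Euc n → ℝ} (hu : ∀ x ∈ Ω, ContDiffAt ℝ 2 u x) (himg : ∀ x ∈ Ω, gradient u x ∈ Ωt)
    {c : ℝ} (hc : ∀ x ∈ Ω, c ≤ MinkDiv u x) :
    c ≤ ((μH[(n : ℝ) - 1] (frontier Ω)).toReal / (volume Ω).toReal) *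
      sSup ((fun y : Euc n => ‖y‖ / Real.sqrt (1 - ‖y‖ ^ 2)) '' frontier Ωt) := by
  obtain ⟨hΩo, -, hΩb, hΩtb, hΩne, -, hht, -, hΩ, -, hunit, -, hθt, -, hH, -⟩ := hdom
  set M := sSup ((fun y : Euc n => ‖y‖ / Real.sqrt (1 - ‖y‖ ^ 2)) '' frontier Ωt) with hM
  have hM0 : 0 ≤ M := Real.sSup_nonneg (by rintro _ ⟨y, _, rfl⟩; positivity)
  rcases le_total c 0 with hc0 | hc0
  · exact hc0.trans (by positivity)
  obtain ⟨m, rfl⟩ : ∃ m, n = m + 1 := ⟨n - 1, by omega⟩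
  have hlt (x : Euc (m + 1)) (hx : x ∈ Ω) : ‖gradient u x‖ < 1 := by
    simpa using hball (subset_closure (himg x hx))
  have hht2 : ContDiff ℝ 2 ht := contDiff_infty.1 hht 2
  have hgrad : Continuous (gradient ht) := continuous_iff_continuousAt.2 fun x =>
    (hht2.contDiffAt.gradient_of_two (x := x)).continuousAt
  have hvol : 0 < (volume Ω).toReal :=
    ENNReal.toReal_pos (hΩo.measure_pos volume hΩne).ne' hΩb.measure_lt_top.ne
  have hV : ContDiffOn ℝ 1
      (fun y => (Real.sqrt (1 - ‖gradient u y‖ ^ 2))⁻¹ • gradient u y) Ω := by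
    intro x hx
    have hg := (hu x hx).gradient_of_two
    have hpos : 0 < 1 - ‖gradient u x‖ ^ 2 := by nlinarith [hlt x hx, norm_nonneg (gradient u x)]
    have hsqrt : ContDiffAt ℝ 1 (fun y => Real.sqrt (1 - ‖gradient u y‖ ^ 2)) x :=
      (contDiffAt_const.sub (hg.norm_sq ℝ)).sqrt hpos.ne'
    exact ((hsqrt.inv (Real.sqrt_pos.2 hpos).ne').smul hg).contDiffWithinAt
  have key := mul_volume_le_mul_hausdorffMeasure_frontier (by omega : 0 < m)
    (hht2.of_le (by norm_num)) hgrad (le_tangent_of_hess_le hht2 hθt hH) hΩ hΩb hunit hV hM0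
    (fun x hx => by
      rw [norm_smul, norm_inv, Real.norm_of_nonneg (Real.sqrt_nonneg _), inv_mul_eq_div]
      exact norm_div_sqrt_le_sSup_frontier hΩtb hball (himg x hx))
    hc0 (fun x hx => by simpa [MinkDiv] using hc x hx)
  rw [show ((m + 1 : ℕ) : ℝ) - 1 = m by push_cast; ring, div_mul_eq_mul_div, le_div_iff₀ hvol,
    mul_comm _ M]
  exact key

/-- A lower bound for the maximal mean curvature in terms of the volume of the gradient image. -/
lemma mul_rpow_volume_ratio_le (hn : 0 < n) {Ω : Set (Euc n)} (hΩ : IsOpen Ω) (hne : Ω.Nonempty)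
    (hb : Bornology.IsBounded Ω) {u : Euc n → ℝ} (hu : ∀ x ∈ Ω, ContDiffAt ℝ 2 u x)
    (h1 : ∀ x ∈ Ω, ‖gradient u x‖ < 1) (hpos : ∀ x ∈ Ω, (Hess u x).PosDef) {K : ℝ}
    (hK : ∀ x ∈ Ω, MinkDiv u x ≤ K) :
    n * ((volume (gradient u '' Ω)).toReal / (volume Ω).toReal) ^ ((1 : ℝ) / n) ≤ K := by
  have hn0 : (0 : ℝ) < n := by exact_mod_cast hn
  have hvol : 0 < (volume Ω).toReal :=
    ENNReal.toReal_pos (hΩ.measure_pos volume hne).ne' hb.measure_lt_top.ne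
  have hK0 : 0 ≤ K := by
    obtain ⟨x, hx⟩ := hne
    exact ((hpos x hx).posSemidef.trace_nonneg).trans
      ((trace_hess_le_minkDiv (hu x hx) (h1 x hx) (hpos x hx)).trans (hK x hx))
  have hle := ENNReal.toReal_mono (ENNReal.mul_ne_top ENNReal.ofReal_ne_top hb.measure_lt_top.ne)
    (volume_gradient_image_le hn hΩ hu h1 hpos hK)
  rw [ENNReal.toReal_mul, ENNReal.toReal_ofReal (by positivity), ← div_le_iff₀ hvol] at hle
  have hroot : ((volume (gradient u '' Ω)).toReal / (volume Ω).toReal) ^ ((1 : ℝ) / n) ≤ K / n := by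
    calc _ ≤ ((K / n) ^ n) ^ ((1 : ℝ) / n) := Real.rpow_le_rpow (by positivity) hle (by positivity)
      _ = K / n := by rw [one_div, Real.pow_rpow_inv_natCast (by positivity) hn.ne']
  rwa [le_div_iff₀ hn0, mul_comm] at hroot

theorem statement_3 {n : ℕ} (hn : 2 ≤ n)
    (Ω Ωt : Set (Euc n)) (ht h : Euc n → ℝ) (θt θ : ℝ)
    (hdom : DomainSetup Ω Ωt ht h θt θ)
    (hball : closure Ωt ⊆ Metric.ball (0 : Euc n) 1)
    (f : Euc n × Euc n → ℝ)
    (hf : ContDiffOn ℝ 2 f (closure Ω ×ˢ closure Ωt))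
    (hosc : OSCcond Ω Ωt f) :
    (∀ (c : ℝ) (u : Euc n → ℝ), IsStrictSol Ω Ωt f c u → ∀ x ∈ Ω,
        f (x, gradient u x) + c ≤
          ((μH[(n : ℝ) - 1] (frontier Ω)).toReal / (volume Ω).toReal) *
              sSup ((fun y : Euc n => ‖y‖ / Real.sqrt (1 - ‖y‖ ^ 2)) '' frontier Ωt) +
            2 * sSup ((fun z => |f z|) '' (closure Ω ×ˢ closure Ωt))) ∧
    ∃ Λ₁ Λ₂ : ℝ, 0 < Λ₁ ∧ 0 < Λ₂ ∧
      ∀ (c : ℝ) (u : Euc n → ℝ), IsStrictSol Ω Ωt f c u → ∀ x ∈ Ω,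
        Λ₁ ≤ MinkDiv u x ∧ MinkDiv u x ≤ Λ₂ := by
  obtain ⟨hΩo, hΩto, hΩb, hΩtb, hΩne, hΩtne, -⟩ := id hdom
  set R := ((μH[(n : ℝ) - 1] (frontier Ω)).toReal / (volume Ω).toReal) *
    sSup ((fun y : Euc n => ‖y‖ / Real.sqrt (1 - ‖y‖ ^ 2)) '' frontier Ωt)
  set S := sSup ((fun z => |f z|) '' (closure Ω ×ˢ closure Ωt))
  have hS (z) (hz : z ∈ closure Ω ×ˢ closure Ωt) : |f z| ≤ S :=
    le_csSup ((hΩb.isCompact_closure.prod hΩtb.isCompact_closure).bddAbove_image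
      hf.continuousOn.abs) ⟨z, hz, rfl⟩
  have hdiff {c : ℝ} {u : Euc n → ℝ} (hsol : IsStrictSol Ω Ωt f c u) (x) (hx : x ∈ Ω) :
      ContDiffAt ℝ 2 u x :=
    hsol.1.contDiffAt (Filter.mem_of_superset (hΩo.mem_nhds hx) subset_closure)
  have himg {c : ℝ} {u : Euc n → ℝ} (hsol : IsStrictSol Ω Ωt f c u) (x) (hx : x ∈ Ω) :
      gradient u x ∈ Ωt := hsol.2.2.2.2 ▸ mem_image_of_mem _ hx
  have upper (c : ℝ) (u : Euc n → ℝ) (hsol : IsStrictSol Ω Ωt f c u) (x) (hx : x ∈ Ω) :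
      f (x, gradient u x) + c ≤ R + 2 * S := by
    have hlow := minkDiv_lower_bound_le hn hdom hball (hdiff hsol) (himg hsol)
      (c := f (x, gradient u x) + c - 2 * S) fun y hy => by
        have h1 := abs_le.1 (hS (x, gradient u x)
          ⟨subset_closure hx, subset_closure (himg hsol x hx)⟩)
        have h2 := abs_le.1 (hS (y, gradient u y)
          ⟨subset_closure hy, subset_closure (himg hsol y hy)⟩)
        rw [hsol.2.2.2.1 y hy]
        linarith
    linarith
  have hvol : 0 < (volume Ω).toReal :=
    ENNReal.toReal_pos (hΩo.measure_pos volume hΩne).ne' hΩb.measure_lt_top.ne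
  have hvolt : 0 < (volume Ωt).toReal :=
    ENNReal.toReal_pos (hΩto.measure_pos volume hΩtne).ne' hΩtb.measure_lt_top.ne
  have hn0 : (0 : ℝ) < n := by exact_mod_cast (by omega : 0 < n)
  refine ⟨upper, (n : ℝ) / 2 * ((volume Ωt).toReal / (volume Ω).toReal) ^ ((1 : ℝ) / n),
    max (R + 2 * S) 1, by positivity, by positivity, fun c u hsol x hx => ⟨?_, ?_⟩⟩
  · have hK := mul_rpow_volume_ratio_le (by omega) hΩo hΩne hΩb (hdiff hsol)
      (fun y hy => hsol.2.2.1 y (subset_closure hy)) (fun y hy => hsol.2.1 y (subset_closure hy))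
      (K := MinkDiv u x + n / 2 * ((volume Ωt).toReal / (volume Ω).toReal) ^ ((1 : ℝ) / n))
      fun y hy => by
        have := (abs_le.1 (hosc y (subset_closure hy) x (subset_closure hx) _
          (subset_closure (himg hsol y hy)) _ (subset_closure (himg hsol x hx)))).2
        rw [hsol.2.2.2.1 y hy, hsol.2.2.2.1 x hx]
        linarith
    rw [hsol.2.2.2.2] at hK
    linarith
  · rw [hsol.2.2.2.1 x hx]
    exact (upper c u hsol x hx).trans (le_max_left _ _)

end
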